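/- arXiv:1906.00931 — 8 statements merged into one kernel-verified Lean document; each statement's English description precedes it below -/
import Mathlib

section
/- Let G be an invertible 2×2 real matrix all of whose entries are nonnegative. Then RGA(G) is invertible and IRGA(G) is doubly stochastic: all of its entries are nonnegative and each of its row sums and column sums equals 1. -/
open Matrix

/-- The relative gain array: `RGA(G) = G ∘ (G⁻¹)ᵀ` (Hadamard product). -/
noncomputable def RGA {n : ℕ} (G : Matrix (Fin n) (Fin n) ℝ) : Matrix (Fin n) (Fin n) ℝ :=
  Matrix.hadamard G (G⁻¹)ᵀ

/-- The inverse relative gain array: `IRGA(G) = (RGA(G))⁻¹`. -/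
noncomputable def IRGA {n : ℕ} (G : Matrix (Fin n) (Fin n) ℝ) : Matrix (Fin n) (Fin n) ℝ :=
  (RGA G)⁻¹

/-- Closed form of the relative gain array of a `2 × 2` matrix. -/
theorem RGA_fin_two (G : Matrix (Fin 2) (Fin 2) ℝ) :
    RGA G = !![G 0 0 * G 1 1 / G.det, -(G 0 1 * G 1 0) / G.det;
      -(G 0 1 * G 1 0) / G.det, G 0 0 * G 1 1 / G.det] := by
  ext i j
  fin_cases i <;> fin_cases j <;>
    simp [RGA, Matrix.inv_def, Matrix.adjugate_fin_two, Ring.inverse_eq_inv'] <;> ring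

/-- Closed form of a right inverse of the relative gain array of a `2 × 2` matrix. -/
theorem RGA_fin_two_mul_eq_one (G : Matrix (Fin 2) (Fin 2) ℝ) (hdet : G.det ≠ 0)
    (hperm : G 0 0 * G 1 1 + G 0 1 * G 1 0 ≠ 0) :
    RGA G * (G 0 0 * G 1 1 + G 0 1 * G 1 0)⁻¹ •
      !![G 0 0 * G 1 1, G 0 1 * G 1 0; G 0 1 * G 1 0, G 0 0 * G 1 1] = 1 := by
  rw [RGA_fin_two]
  have hd := Matrix.det_fin_two G
  ext i j
  fin_cases i <;> fin_cases j <;> simp [Matrix.mul_apply, Fin.sum_univ_two] <;> field_simp <;>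
    rw [hd] <;> ring

/-- For every invertible entrywise-nonnegative real `2 × 2` matrix `G`, `RGA G` is
invertible and `IRGA G` is doubly stochastic: entrywise nonnegative with all row
sums and column sums equal to `1`. -/
theorem irga_two_by_two_nonneg_doubly_stochastic (G : Matrix (Fin 2) (Fin 2) ℝ)
    (hG : IsUnit G.det) (hpos : ∀ i j, 0 ≤ G i j) :
    IsUnit (RGA G).det ∧
      (∀ i j, 0 ≤ IRGA G i j) ∧
      (∀ i, ∑ j, IRGA G i j = 1) ∧
      (∀ j, ∑ i, IRGA G i j = 1) := by 
  have hdet : G.det ≠ 0 := hG.ne_zero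
  have had : 0 ≤ G 0 0 * G 1 1 := mul_nonneg (hpos 0 0) (hpos 1 1)
  have hbc : 0 ≤ G 0 1 * G 1 0 := mul_nonneg (hpos 0 1) (hpos 1 0)
  have hperm : G 0 0 * G 1 1 + G 0 1 * G 1 0 ≠ 0 := by
    intro h
    apply hdet
    rw [Matrix.det_fin_two]
    linarith
  have hmul := RGA_fin_two_mul_eq_one G hdet hperm
  refine ⟨Matrix.isUnit_det_of_right_inverse hmul, ?_⟩
  rw [IRGA, Matrix.inv_eq_right_inv hmul]
  refine ⟨fun i j => ?_, fun i => ?_, fun j => ?_⟩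
  · fin_cases i <;> fin_cases j <;> simp <;> positivity
  · fin_cases i <;> simp [Fin.sum_univ_two] <;> field_simp <;> ring
  · fin_cases j <;> simp [Fin.sum_univ_two] <;> field_simp <;> ring
end

section
/- Let n ≤ 4 and let G be a real symmetric positive-definite n×n matrix. Then RGA(G) is invertible, and IRGA(G) is symmetric positive-definite, has all row sums and column sums equal to 1, and has all entries nonnegative; hence IRGA(G) is doubly stochastic and doubly nonnegative. -/
open Matrix

theorem quadForm_gain_nonneg {c s : ℝ} (hc : c ^ 2 ≤ 1) (p q e f : ℝ) :
    0 ≤ (s ^ 2 + (1 - c ^ 2) ^ 2 * (s * q + q ^ 2)) * e ^ 2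
      + (s ^ 2 + (1 - c ^ 2) ^ 2 * (s * p + p ^ 2)) * f ^ 2
      + 2 * (c * (c ^ 2 * s ^ 2 + (1 - c ^ 2) ^ 2 * (p * q))) * (e * f) := by
  have form (x y : ℝ) : 0 ≤ x ^ 2 + y ^ 2 + 2 * c * x * y := by
    nlinarith [sq_nonneg (x + c * y), mul_nonneg (sub_nonneg.2 hc) (sq_nonneg y)]
  have h₁ := form ((1 - c ^ 2) * (q * e) + s * (e - c * f) / 2)
    ((1 - c ^ 2) * (p * f) + s * (f - c * e) / 2)
  have h₂ := mul_nonneg (sq_nonneg s) (mul_nonneg (by positivity : 0 ≤ 1 + 3 * c ^ 2) (form e f))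
  have h₃ := mul_nonneg (sq_nonneg s)
    (mul_nonneg (sub_nonneg.2 hc) (add_nonneg (sq_nonneg e) (sq_nonneg f)))
  linear_combination h₁ + h₂ / 4 + h₃ / 2

theorem constantTerm_nonneg {c s : ℝ} (hc : c ^ 2 ≤ 1) (p q v : ℝ) :
    0 ≤ s ^ 2 * (1 + c ^ 2) + s * (1 + c ^ 2) * (p + q + c * v)
      + (p + q + c * v) * (p + q + c * c ^ 2 * v) - 2 * (1 - c ^ 2) ^ 2 * (p * q)
      + c ^ 2 * (1 - c ^ 2) * (v ^ 2 - 4 * (p * q)) := by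
  have hc' := sub_nonneg.2 hc
  have h₁ := mul_nonneg (by positivity : 0 ≤ 1 + c ^ 2) (sq_nonneg (s + (p + q + c * v) / 2))
  have h₂ := mul_nonneg (mul_nonneg hc' (by positivity : 0 ≤ 1 + c ^ 2)) (sq_nonneg (p - q))
  have h₃ : 0 ≤ (2 * c ^ 4 - c ^ 2 + 1) * (p + q) ^ 2 + 2 * (1 + c ^ 2) * (p + q) * (c * v)
      + (3 - c ^ 2) * (c * v) ^ 2 := by
    refine (mul_nonneg_iff_of_pos_left (by linarith : 0 < 3 - c ^ 2)).1 ?_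
    have h₄ := mul_nonneg (pow_nonneg hc' 3) (sq_nonneg (p + q))
    have h₅ := sq_nonneg ((3 - c ^ 2) * (c * v) + (1 + c ^ 2) * (p + q))
    linear_combination h₅ + 2 * h₄
  linear_combination h₁ + h₂ / 2 + h₃ / 4

/-- Cofactor inequality for the `4 × 4` relative gain array. Here `c` and `-s` are the off-diagonal
entries of the lower block of `G` and the upper block of `G⁻¹`, both with unit diagonal, and the
rows of `G₁₂ G₂₂⁻¹` are `(a, A)` and `(b, B)`. Cleared of denominators, the cofactor is the sum of
the nonnegative terms `g0` to `g4`. -/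
theorem cofactor_poly_nonneg {c s : ℝ} (hc : c ^ 2 < 1) (hs : s ^ 2 < 1)
    (a A b B : ℝ) (m01 m02 m03 m12 m13 m22 m23 m33 : ℝ)
    (h01 : (1 - s ^ 2) * m01 = -s * (s + (1 - s ^ 2) * (a * b + A * B + c * (a * B + A * b))))
    (h02 : m02 = -(a + c * A) * (a - s * b)) (h03 : m03 = -(c * a + A) * (A - s * B))
    (h12 : m12 = -(b + c * B) * (b - s * a)) (h13 : m13 = -(c * b + B) * (B - s * A))
    (h22 : (1 - c ^ 2) * m22 = 1 + (1 - c ^ 2) * (a ^ 2 + b ^ 2 - 2 * s * a * b))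
    (h33 : (1 - c ^ 2) * m33 = 1 + (1 - c ^ 2) * (A ^ 2 + B ^ 2 - 2 * s * A * B))
    (h23 : (1 - c ^ 2) * m23 =
      c * (-c + (1 - c ^ 2) * (a * A + b * B - s * (a * B + A * b)))) :
    0 ≤ m02 * (m33 * m12 - m23 * m13) + m03 * (m22 * m13 - m23 * m12)
      - m01 * (m22 * m33 - m23 ^ 2) := by
  have hc' := sub_pos.2 hc
  have hs' := sub_pos.2 hs
  have g0 := constantTerm_nonneg (s := s) hc.le ((1 - s ^ 2) * (a * b)) ((1 - s ^ 2) * (A * B))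
    ((1 - s ^ 2) * (a * B + A * b))
  have g1 := quadForm_gain_nonneg (s := s) hc.le ((1 - s ^ 2) * (a * b)) ((1 - s ^ 2) * (A * B))
    (a - s * b) (A - s * B)
  have g2 := mul_nonneg hs'.le
    (quadForm_gain_nonneg (s := s) hc.le ((1 - s ^ 2) * (a * b)) ((1 - s ^ 2) * (A * B)) b B)
  have g3 := mul_nonneg (mul_nonneg (sq_nonneg s) hc'.le)
    (add_nonneg (mul_nonneg hc'.le (sq_nonneg (a * A + b * B - s * (a * B + A * b))))
      (mul_nonneg hs'.le (sq_nonneg (a * B - A * b))))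
  have g4 := mul_nonneg (mul_nonneg (mul_nonneg (sq_nonneg c) hc'.le) (mul_nonneg hs'.le
    (sq_nonneg s))) (sq_nonneg (a * B - A * b))
  have key := add_nonneg (add_nonneg (add_nonneg (add_nonneg g0 g1) g2) g3) g4
  have e01 : m01 = -s * (s + (1 - s ^ 2) * (a * b + A * B + c * (a * B + A * b))) / (1 - s ^ 2) := by
    rw [eq_div_iff hs'.ne']; linear_combination h01
  have e22 : m22 = (1 + (1 - c ^ 2) * (a ^ 2 + b ^ 2 - 2 * s * a * b)) / (1 - c ^ 2) := by
    rw [eq_div_iff hc'.ne']; linear_combination h22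
  have e33 : m33 = (1 + (1 - c ^ 2) * (A ^ 2 + B ^ 2 - 2 * s * A * B)) / (1 - c ^ 2) := by
    rw [eq_div_iff hc'.ne']; linear_combination h33
  have e23 : m23 = c * (-c + (1 - c ^ 2) * (a * A + b * B - s * (a * B + A * b))) / (1 - c ^ 2) := by
    rw [eq_div_iff hc'.ne']; linear_combination h23
  have hne := hc'.ne'
  have hne' := hs'.ne'
  refine (mul_nonneg_iff_of_pos_left (mul_pos hs' hc')).1 (key.trans_eq ?_)
  rw [e01, e22, e33, e23, h02, h03, h12, h13]
  field_simp
  ring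

theorem hadamard_adjugate_nonneg_of_normalized {G H : Matrix (Fin 4) (Fin 4) ℝ}
    (hG : G.IsSymm) (hH : H.IsSymm) (hGH : G * H = 1)
    (hG₂ : G 2 2 = 1) (hG₃ : G 3 3 = 1) (hH₀ : H 0 0 = 1) (hH₁ : H 1 1 = 1)
    (hc : G 2 3 ^ 2 < 1) (hs : H 0 1 ^ 2 < 1) :
    0 ≤ (G ⊙ H).adjugate 0 1 := by
  have g (i j) : G j i = G i j := hG.apply i j
  have h (i j) : H j i = H i j := hH.apply i j
  have eq (i j) : G i 0 * H 0 j + G i 1 * H 1 j + G i 2 * H 2 j + G i 3 * H 3 j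
      = if i = j then 1 else 0 := by
    rw [← Fin.sum_univ_four (fun k ↦ G i k * H k j), ← Matrix.mul_apply, hGH, Matrix.one_apply]
  obtain ⟨c, hc₀⟩ : ∃ c, G 2 3 = c := ⟨_, rfl⟩
  obtain ⟨s, hs₀⟩ : ∃ s, H 0 1 = -s := ⟨-H 0 1, by ring⟩
  rw [hc₀] at hc
  rw [hs₀, neg_sq] at hs
  have hc' := (sub_pos.2 hc).ne'
  have hs' := (sub_pos.2 hs).ne'
  have solve (x y : ℝ) : ∃ a A, x = a + c * A ∧ y = c * a + A :=
    ⟨(x - c * y) / (1 - c ^ 2), (y - c * x) / (1 - c ^ 2), by field_simp; ring,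
      by field_simp; ring⟩
  obtain ⟨a, A, ha, hA⟩ := solve (G 0 2) (G 0 3)
  obtain ⟨b, B, hb, hB⟩ := solve (G 1 2) (G 1 3)
  have e00 := eq 0 0
  have e01 := eq 0 1
  have e20 := eq 2 0
  have e30 := eq 3 0
  have e21 := eq 2 1
  have e31 := eq 3 1
  have e22 := eq 2 2
  have e32 := eq 3 2
  have e23 := eq 2 3
  have e33 := eq 3 3
  simp only [g 0 2, g 0 3, g 1 2, g 1 3, g 2 3, h 0 1, h 0 2, h 0 3, h 1 2, h 1 3, h 2 3,
    hG₂, hG₃, hH₀, hH₁, hc₀, hs₀, ha, hA, hb, hB, if_true, Fin.reduceEq, if_false]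
    at e00 e01 e20 e30 e21 e31 e22 e32 e23 e33
  have h02 : H 0 2 = -(a - s * b) :=
    mul_left_cancel₀ hc' (by linear_combination e20 - c * e30)
  have h03 : H 0 3 = -(A - s * B) :=
    mul_left_cancel₀ hc' (by linear_combination e30 - c * e20)
  have h12 : H 1 2 = -(b - s * a) :=
    mul_left_cancel₀ hc' (by linear_combination e21 - c * e31)
  have h13 : H 1 3 = -(B - s * A) :=
    mul_left_cancel₀ hc' (by linear_combination e31 - c * e21)
  rw [h02, h12] at e22 e32
  rw [h03, h13] at e23 e33
  rw [h02, h03] at e00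
  rw [h12, h13] at e01
  have key := cofactor_poly_nonneg hc hs a A b B (G 0 1 * H 0 1) (G 0 2 * H 0 2)
    (G 0 3 * H 0 3) (G 1 2 * H 1 2) (G 1 3 * H 1 3) (H 2 2) (c * H 2 3) (H 3 3)
    (by rw [hs₀]; linear_combination (-s) * (e01 + s * e00))
    (by rw [ha, h02]; ring) (by rw [hA, h03]; ring) (by rw [hb, h12]; ring)
    (by rw [hB, h13]; ring)
    (by linear_combination e22 - c * e32)
    (by linear_combination e33 - c * e23)
    (by linear_combination c * (e32 - c * e22))
  rw [Matrix.adjugate_fin_succ_eq_det_submatrix, Matrix.det_fin_three]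
  simp [Fin.succAbove, Matrix.hadamard_apply, g 1 2, g 1 3, g 2 3,
    h 1 2, h 1 3, h 2 3, hG₂, hG₃, hc₀, Fin.lt_def]
  linear_combination key

theorem sq_apply_lt_of_posDef {ι : Type*} [Fintype ι] {G : Matrix ι ι ℝ} (hG : G.PosDef) {i j : ι}
    (hij : i ≠ j) : G i j ^ 2 < G i i * G j j := by
  have hinj : Function.Injective ![i, j] := by
    intro x y; fin_cases x <;> fin_cases y <;> simp [hij, hij.symm]
  have h := (hG.submatrix hinj).det_pos
  have hs : G j i = G i j := by simpa using hG.isHermitian.apply i j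
  rw [det_fin_two] at h
  simp only [submatrix_apply, cons_val_zero, cons_val_one, hs] at h
  linarith

/-- The relative gain array is invariant under diagonal congruence, so the diagonal can be
normalized. -/
theorem hadamard_inv_adjugate_nonneg {G : Matrix (Fin 4) (Fin 4) ℝ} (hG : G.PosDef) :
    0 ≤ (G ⊙ G⁻¹).adjugate 0 1 := by
  have hH := hG.inv
  set H := G⁻¹
  have hGH : G * H = 1 := Matrix.mul_nonsing_inv _ hG.det_pos.ne'.isUnit
  have hGs : Gᵀ = G := by simpa using hG.isHermitian.eq
  have hHs : Hᵀ = H := by simpa using hH.isHermitian.eq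
  let e : Fin 4 → ℝ := ![√(H 0 0), √(H 1 1), (√(G 2 2))⁻¹, (√(G 3 3))⁻¹]
  have hg (i) : 0 < √(G i i) := Real.sqrt_pos.2 hG.diag_pos
  have hh (i) : 0 < √(H i i) := Real.sqrt_pos.2 hH.diag_pos
  have sg (i) : √(G i i) ^ 2 = G i i := Real.sq_sqrt hG.diag_pos.le
  have sh (i) : √(H i i) ^ 2 = H i i := Real.sq_sqrt hH.diag_pos.le
  have he (i) : e i ≠ 0 := by
    fin_cases i <;> simp [e, (hg _).ne', (hh _).ne']
  let G' := diagonal e * G * diagonal e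
  let H' := diagonal e⁻¹ * H * diagonal e⁻¹
  have hG' (i j) : G' i j = e i * G i j * e j := by simp [G', Matrix.mul_apply, diagonal]
  have hH' (i j) : H' i j = (e i)⁻¹ * H i j * (e j)⁻¹ := by
    simp [H', Matrix.mul_apply, diagonal]
  have hee : diagonal e * diagonal e⁻¹ = 1 := by
    rw [diagonal_mul_diagonal, ← diagonal_one]; congr 1; ext i; simp [he i]
  have heq : G ⊙ H = G' ⊙ H' := by
    ext i j
    have := he i
    have := he j
    rw [hadamard_apply, hadamard_apply, hG', hH']
    field_simp
  rw [heq]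
  apply hadamard_adjugate_nonneg_of_normalized
  · simp [IsSymm, G', hGs, Matrix.mul_assoc]
  · simp [IsSymm, H', hHs, Matrix.mul_assoc]
  · calc G' * H' = diagonal e * G * (diagonal e * diagonal e⁻¹) * H * diagonal e⁻¹ := by
          simp only [G', H', Matrix.mul_assoc]
      _ = 1 := by rw [hee, Matrix.mul_one, Matrix.mul_assoc (diagonal e), hGH, Matrix.mul_one, hee]
  · have := (hg 2).ne'
    rw [hG']
    simp only [e, cons_val]
    field_simp
    exact (sg 2).symm
  · have := (hg 3).ne'
    rw [hG']
    simp only [e, cons_val]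
    field_simp
    exact (sg 3).symm
  · have := (hh 0).ne'
    rw [hH']
    simp only [e, cons_val]
    field_simp
    exact (sh 0).symm
  · have := (hh 1).ne'
    rw [hH']
    simp only [e, cons_val]
    field_simp
    exact (sh 1).symm
  · have := sq_apply_lt_of_posDef hG (show (2 : Fin 4) ≠ 3 by decide)
    rw [hG']
    simp only [e, mul_pow, inv_pow, cons_val, sg]
    have h2 := hG.diag_pos (i := 2)
    have h3 := hG.diag_pos (i := 3)
    rw [inv_mul_eq_div, ← div_eq_mul_inv, div_div, div_lt_one (by positivity)]; exact this
  · have := sq_apply_lt_of_posDef hH (show (0 : Fin 4) ≠ 1 by decide)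
    rw [hH']
    simp only [e, mul_pow, inv_pow, cons_val, sh]
    have h2 := hH.diag_pos (i := 0)
    have h3 := hH.diag_pos (i := 1)
    rw [inv_mul_eq_div, ← div_eq_mul_inv, div_div, div_lt_one (by positivity)]; exact this

theorem hadamard_inv_inv_apply_zero_one_nonneg {G : Matrix (Fin 4) (Fin 4) ℝ} (hG : G.PosDef) :
    0 ≤ (G ⊙ G⁻¹)⁻¹ 0 1 := by
  rw [Matrix.inv_def, Matrix.smul_apply, Ring.inverse_eq_inv', smul_eq_mul]
  exact mul_nonneg (inv_nonneg.2 (hG.hadamard hG.inv).det_pos.le) (hadamard_inv_adjugate_nonneg hG)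

/-- Any two distinct indices can be moved to `0` and `1` while padding `Fin n` to `Fin 4`. -/
theorem exists_sum_equiv_fin_four {n : ℕ} (hn : n ≤ 4) {i j : Fin n} (hij : i ≠ j) :
    ∃ e : Fin n ⊕ Fin (4 - n) ≃ Fin 4, e (.inl i) = 0 ∧ e (.inl j) = 1 := by
  let e₀ : Fin n ⊕ Fin (4 - n) ≃ Fin 4 :=
    finSumFinEquiv.trans (finCongr (Nat.add_sub_cancel' hn))
  let e₁ := e₀.trans (Equiv.swap (e₀ (.inl i)) 0)
  have hi : e₁ (.inl i) = 0 := by simp [e₁]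
  have hj : e₁ (.inl j) ≠ 0 := fun h ↦
    hij (Sum.inl_injective (e₁.injective (hi.trans h.symm)))
  refine ⟨e₁.trans (Equiv.swap (e₁ (.inl j)) 1), ?_, by simp⟩
  rw [Equiv.trans_apply, hi, Equiv.swap_apply_of_ne_of_ne hj.symm (by decide)]

theorem posDef_fromBlocks_zero {m n : Type*} [Fintype m] [Fintype n] {A : Matrix m m ℝ}
    {D : Matrix n n ℝ} (hA : A.PosDef) (hD : D.PosDef) : (fromBlocks A 0 0 D).PosDef := by
  refine .of_dotProduct_mulVec_pos
    (hA.isHermitian.fromBlocks (by simp) hD.isHermitian) fun x hx ↦ ?_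
  obtain ⟨y, z, rfl⟩ : ∃ y z, x = Sum.elim y z :=
    ⟨x ∘ Sum.inl, x ∘ Sum.inr, (Sum.elim_comp_inl_inr x).symm⟩
  have hy := hA.posSemidef.dotProduct_mulVec_nonneg y
  have hz := hD.posSemidef.dotProduct_mulVec_nonneg z
  have hsum : star (Sum.elim y z) ⬝ᵥ fromBlocks A 0 0 D *ᵥ Sum.elim y z
      = star y ⬝ᵥ A *ᵥ y + star z ⬝ᵥ D *ᵥ z := by
    simp [fromBlocks_mulVec, dotProduct]
  rw [hsum]
  by_cases hy₀ : y = 0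
  · have hz₀ : z ≠ 0 := by
      rintro rfl
      exact hx (by ext (i | i) <;> simp [hy₀])
    exact add_pos_of_nonneg_of_pos hy (hD.dotProduct_mulVec_pos hz₀)
  · exact add_pos_of_pos_of_nonneg (hA.dotProduct_mulVec_pos hy₀) hz

theorem hadamard_inv_inv_apply_nonneg {n : ℕ} (hn : n ≤ 4) {G : Matrix (Fin n) (Fin n) ℝ}
    (hG : G.PosDef) (i j : Fin n) : 0 ≤ (G ⊙ G⁻¹)⁻¹ i j := by
  have hM := hG.hadamard hG.inv
  obtain rfl | hij := eq_or_ne i j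
  · exact hM.inv.diag_pos.le
  obtain ⟨e, hi, hj⟩ := exists_sum_equiv_fin_four hn hij
  let K := fromBlocks G 0 0 (1 : Matrix (Fin (4 - n)) (Fin (4 - n)) ℝ)
  have hKinv : K⁻¹ = fromBlocks G⁻¹ 0 0 1 := inv_eq_right_inv (by
    simp [K, fromBlocks_multiply, mul_nonsing_inv _ hG.det_pos.ne'.isUnit])
  have hKM : K ⊙ K⁻¹ = fromBlocks (G ⊙ G⁻¹) 0 0 1 := by
    rw [hKinv]
    ext (x | x) (y | y) <;> simp [K, one_apply]
  have hKMinv : (K ⊙ K⁻¹)⁻¹ = fromBlocks (G ⊙ G⁻¹)⁻¹ 0 0 1 := by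
    rw [hKM]
    exact inv_eq_right_inv (by
      simp [fromBlocks_multiply, mul_nonsing_inv _ hM.det_pos.ne'.isUnit])
  have hK : K.PosDef := posDef_fromBlocks_zero hG .one
  have key := hadamard_inv_inv_apply_zero_one_nonneg (hK.submatrix e.symm.injective)
  rw [inv_submatrix_equiv, ← submatrix_hadamard, inv_submatrix_equiv, hKMinv] at key
  simpa [← hi, ← hj] using key

theorem hadamard_inv_transpose_mulVec_one {ι : Type*} [Fintype ι] [DecidableEq ι]
    {G : Matrix ι ι ℝ} (hG : IsUnit G.det) : (G ⊙ G⁻¹ᵀ) *ᵥ 1 = 1 := by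
  ext i
  simpa [mulVec, dotProduct, mul_apply] using congr_fun₂ (mul_nonsing_inv G hG) i i

/-- For `n ≤ 4` and `G` real symmetric positive-definite, `RGA G` is invertible and
`IRGA G` is symmetric positive-definite, has all row and column sums equal to `1`,
and is entrywise nonnegative; hence it is doubly stochastic and doubly nonnegative. -/
theorem irga_doubly_nonneg_of_dim_le_four {n : ℕ} (hn : n ≤ 4)
    (G : Matrix (Fin n) (Fin n) ℝ) (hG : G.PosDef) :
    IsUnit (RGA G).det ∧
      (IRGA G).PosDef ∧
      (∀ i, ∑ j, IRGA G i j = 1) ∧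
      (∀ j, ∑ i, IRGA G i j = 1) ∧
      (∀ i j, 0 ≤ IRGA G i j) := by
  have hdet := hG.det_pos.ne'.isUnit
  have hsymm : (G⁻¹)ᵀ = G⁻¹ := by simpa using hG.inv.isHermitian.eq
  have hRGA : RGA G = G ⊙ G⁻¹ := by rw [RGA, hsymm]
  have hpos : (RGA G).PosDef := hRGA ▸ hG.hadamard hG.inv
  have hunit := hpos.det_pos.ne'.isUnit
  have hrow (i : Fin n) : ∑ j, IRGA G i j = 1 := by
    have h : IRGA G *ᵥ 1 = 1 := by
      conv_lhs => rw [← hadamard_inv_transpose_mulVec_one hdet]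
      change (RGA G)⁻¹ *ᵥ (RGA G *ᵥ 1) = 1
      rw [mulVec_mulVec, nonsing_inv_mul _ hunit, one_mulVec]
    simpa [mulVec, dotProduct] using congr_fun h i
  have hI : (IRGA G).PosDef := hpos.inv
  refine ⟨hunit, hI, hrow, fun j ↦ ?_, fun i j ↦ ?_⟩
  · rw [← hrow j]
    exact Finset.sum_congr rfl fun i _ ↦ by simpa using hI.isHermitian.apply j i
  · rw [IRGA, hRGA]
    exact hadamard_inv_inv_apply_nonneg hn hG i j
end

section
/- Let n ≤ 4 and let G be a real n×n matrix that is positive-definite up to permutations, i.e., there exist n×n permutation matrices P and Q such that P·G·Q is symmetric positive-definite. Then RGA(G) is invertible, IRGA(G) is positive-definite up to permutations (there exist permutation matrices P', Q' with P'·IRGA(G)·Q' symmetric positive-definite), all row sums and column sums of IRGA(G) equal 1, and all entries of IRGA(G) are nonnegative, so IRGA(G) is doubly stochastic. -/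
open Matrix

/-- A permutation matrix: a 0–1 matrix with exactly one `1` in each row and each column. -/
def IsPermMatrix {n : ℕ} (P : Matrix (Fin n) (Fin n) ℝ) : Prop :=
  (∀ i j, P i j = 0 ∨ P i j = 1) ∧ (∀ i, ∃! j, P i j = 1) ∧ (∀ j, ∃! i, P i j = 1)

section RelativeGain

variable {ι κ : Type*} [Fintype ι] [DecidableEq ι] [Fintype κ] [DecidableEq κ]

/-- The relative gain array over an arbitrary finite index type. -/
noncomputable def relGain (G : Matrix ι ι ℝ) : Matrix ι ι ℝ :=
  G ⊙ (G⁻¹)ᵀ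

theorem relGain_submatrix (G : Matrix ι ι ℝ) (e f : κ ≃ ι) :
    relGain (G.submatrix e f) = (relGain G).submatrix e f := by
  ext i j
  simp [relGain, inv_submatrix_equiv]

theorem inv_relGain_submatrix (G : Matrix ι ι ℝ) (e f : κ ≃ ι) :
    (relGain (G.submatrix e f))⁻¹ = (relGain G)⁻¹.submatrix f e := by
  rw [relGain_submatrix, inv_submatrix_equiv]

theorem relGain_diagonal_mul_mul_diagonal (G : Matrix ι ι ℝ) {d : ι → ℝ} (hd : ∀ i, d i ≠ 0) :
    relGain (diagonal d * G * diagonal d) = relGain G := by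
  have hinv : (diagonal d)⁻¹ = diagonal fun i => (d i)⁻¹ := by
    apply inv_eq_right_inv
    simp [diagonal_mul_diagonal, hd]
  ext i j
  have hi := hd i
  have hj := hd j
  simp only [relGain, Matrix.mul_inv_rev, hinv, hadamard_apply, transpose_apply, diagonal_mul,
    mul_diagonal]
  field_simp

theorem relGain_mulVec_one {G : Matrix ι ι ℝ} (hG : IsUnit G.det) :
    relGain G *ᵥ 1 = 1 := by
  ext i
  have h := congrFun (congrFun (mul_nonsing_inv G hG) i) i
  simpa [relGain, mulVec, dotProduct, mul_apply] using h

theorem one_vecMul_relGain {G : Matrix ι ι ℝ} (hG : IsUnit G.det) :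
    1 ᵥ* relGain G = 1 := by
  ext j
  have h := congrFun (congrFun (nonsing_inv_mul G hG) j) j
  simpa [relGain, vecMul, dotProduct, mul_apply, mul_comm] using h

theorem relGain_posDef {G : Matrix ι ι ℝ} (hG : G.PosDef) : (relGain G).PosDef :=
  hG.hadamard hG.inv.transpose

theorem relGain_fromBlocks_one {G : Matrix ι ι ℝ} (hG : IsUnit G) :
    relGain (fromBlocks G 0 0 (1 : Matrix κ κ ℝ)) = fromBlocks (relGain G) 0 0 1 := by
  have hinv : (fromBlocks G 0 0 (1 : Matrix κ κ ℝ))⁻¹ = fromBlocks G⁻¹ 0 0 1 := by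
    rw [inv_fromBlocks_zero₂₁_of_isUnit_iff _ _ _ (by simp [hG])]
    simp
  rw [relGain, hinv]
  ext (i | i) (j | j) <;> simp [relGain, one_apply, eq_comm]

end RelativeGain

theorem posDef_fromBlocks_one {ι κ : Type*} [Fintype ι] [Fintype κ] [DecidableEq κ]
    {G : Matrix ι ι ℝ} (hG : G.PosDef) :
    (fromBlocks G 0 0 (1 : Matrix κ κ ℝ)).PosDef := by
  refine .of_dotProduct_mulVec_pos ?_ fun x hx => ?_
  · exact hG.isHermitian.fromBlocks (by simp) isHermitian_one
  · obtain ⟨u, v, rfl⟩ : ∃ u v, x = Sum.elim u v := ⟨_, _, (Sum.elim_comp_inl_inr x).symm⟩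
    have hu := hG.posSemidef.dotProduct_mulVec_nonneg u
    have hv := PosSemidef.one (n := κ) (R := ℝ) |>.dotProduct_mulVec_nonneg v
    have key : star (Sum.elim u v) ⬝ᵥ fromBlocks G 0 0 (1 : Matrix κ κ ℝ) *ᵥ Sum.elim u v
        = star u ⬝ᵥ G *ᵥ u + star v ⬝ᵥ (1 : Matrix κ κ ℝ) *ᵥ v := by
      simp [fromBlocks_mulVec, dotProduct]
    rw [key]
    by_cases h : u = 0
    · have : v ≠ 0 := by
        rintro rfl
        apply hx
        ext (i | i) <;> simp [h]
      exact add_pos_of_nonneg_of_pos hu (PosDef.one.dotProduct_mulVec_pos this)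
    · exact add_pos_of_pos_of_nonneg (hG.dotProduct_mulVec_pos h) hv

/-- The quadratic form arising from one symmetry type of the odd part of the cofactor below. -/
theorem odd_part_nonneg {r s l m ρ : ℝ} (hρ : ρ = 1 - r ^ 2) (hr : 0 ≤ 1 + r) (hs : 0 ≤ 1 - s) :
    0 ≤ (1 - s) * (s ^ 2 * (1 + r ^ 3) * l ^ 2 + s * ρ ^ 2 * l * m + ρ ^ 2 * (1 + r) * m ^ 2) := by
  have h : s ^ 2 * (1 + r ^ 3) * l ^ 2 + s * ρ ^ 2 * l * m + ρ ^ 2 * (1 + r) * m ^ 2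
      = (1 + r) * ((ρ * m + s * (1 - r) * l / 2) ^ 2
        + (s * l) ^ 2 * ((1 - r) ^ 2 + 2 * (1 + r ^ 2)) / 4) := by
    subst hρ
    ring
  rw [h]
  positivity

/-- A cleared-denominator form of the cofactor of `relGain G` at an off-diagonal position, as a
polynomial in the parameters of a normalized `4 × 4` positive definite matrix. -/
theorem cofactor_polynomial_nonneg {r s : ℝ} (hr : r ^ 2 < 1) (hs : s ^ 2 < 1) (a b c d : ℝ)
    {ρ σ q α β γ p₁₃ p₁₄ p₂₃ p₂₄ : ℝ}
    (hρ : ρ = 1 - r ^ 2) (hσ : σ = 1 - s ^ 2) (hq : q = a * c + b * d + r * (a * d + b * c))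
    (hα : α = a ^ 2 - 2 * s * a * c + c ^ 2) (hβ : β = b ^ 2 - 2 * s * b * d + d ^ 2)
    (hγ : γ = a * b - s * (a * d + b * c) + c * d)
    (h₁₃ : p₁₃ = (a + r * b) * (a - s * c)) (h₁₄ : p₁₄ = (b + r * a) * (b - s * d))
    (h₂₃ : p₂₃ = (c + r * d) * (c - s * a)) (h₂₄ : p₂₄ = (d + r * c) * (d - s * b)) :
    0 ≤ s * (s + σ * q) * (1 + r ^ 2 + α + β + 2 * r ^ 3 * γ + ρ * (α * β - r ^ 2 * γ ^ 2))
      + σ * (p₁₃ * p₂₃ * (1 + ρ * β) + p₁₄ * p₂₄ * (1 + ρ * α)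
        + (p₁₃ * p₂₄ + p₁₄ * p₂₃) * (r ^ 2 - ρ * r * γ)) := by
  obtain ⟨hr₁, hr₂⟩ := abs_lt.mp ((sq_lt_one_iff_abs_lt_one r).mp hr)
  obtain ⟨hs₁, hs₂⟩ := abs_lt.mp ((sq_lt_one_iff_abs_lt_one s).mp hs)
  have hρ₀ : 0 ≤ ρ := by linarith
  have hσ₀ : 0 ≤ σ := by linarith
  have even : 0 ≤ (1 + r ^ 2) * (s ^ 2 + s * (σ * q) + (σ * q) ^ 2 / 2)
      + σ ^ 2 * ρ / 2 * (a * c - b * d) ^ 2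
      + s ^ 2 * ρ ^ 2 * (a * b + c * d - s * (a * d + b * c)) ^ 2
      + σ * ρ * (s ^ 2 * (1 + r ^ 2 / 2) + r ^ 2 / 2) * (a * d - b * c) ^ 2 := by
    have : 0 ≤ s ^ 2 + s * (σ * q) + (σ * q) ^ 2 / 2 := by
      nlinarith [sq_nonneg (s + σ * q), sq_nonneg s]
    positivity
  have o₁ := odd_part_nonneg (l := a + b + c + d)
    (m := σ * (b * c * d + a * c * d + a * b * d + a * b * c)) hρ (by linarith : 0 ≤ 1 + r)
    (by linarith : 0 ≤ 1 - s)
  have o₂ := odd_part_nonneg (r := -r) (l := a - b + c - d) (ρ := ρ)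
    (m := σ * (b * c * d - a * c * d + a * b * d - a * b * c)) (by rw [hρ]; ring)
    (by linarith) (by linarith : 0 ≤ 1 - s)
  have o₃ := odd_part_nonneg (s := -s) (l := a + b - c - d)
    (m := σ * (b * c * d + a * c * d - a * b * d - a * b * c)) hρ (by linarith : 0 ≤ 1 + r)
    (by linarith)
  have o₄ := odd_part_nonneg (r := -r) (s := -s) (l := a - b - c + d) (ρ := ρ)
    (m := σ * (b * c * d - a * c * d - a * b * d + a * b * c)) (by rw [hρ]; ring)
    (by linarith) (by linarith)
  refine (add_nonneg even (div_nonneg (add_nonneg (add_nonneg o₁ o₂) (add_nonneg o₃ o₄))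
    (zero_le_four (α := ℝ)))).trans_eq ?_
  subst hρ hσ hq hα hβ hγ h₁₃ h₁₄ h₂₃ h₂₄
  ring

/-- Nonnegativity of the `(0, 1)` cofactor of the relative gain array of a symmetric `G` with
symmetric inverse `H`, in terms of entries normalized so that `H 0 0 = H 1 1 = 1`,
`G 2 2 = G 3 3 = 1`, `H 0 1 = -s` and `G 2 3 = r`. -/
theorem cofactor_nonneg_of_normalized {r s g₀₀ g₀₁ g₀₂ g₀₃ g₁₂ g₁₃ h₀₂ h₀₃ h₁₂ h₁₃ h₂₂ h₂₃ h₃₃ : ℝ}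
    (hr : r ^ 2 < 1) (hs : s ^ 2 < 1)
    (e₀₀ : g₀₀ - g₀₁ * s + g₀₂ * h₀₂ + g₀₃ * h₀₃ = 1)
    (e₀₁ : -(g₀₀ * s) + g₀₁ + g₀₂ * h₁₂ + g₀₃ * h₁₃ = 0)
    (e₂₀ : g₀₂ - g₁₂ * s + h₀₂ + r * h₀₃ = 0)
    (e₃₀ : g₀₃ - g₁₃ * s + r * h₀₂ + h₀₃ = 0)
    (e₂₁ : -(g₀₂ * s) + g₁₂ + h₁₂ + r * h₁₃ = 0)
    (e₃₁ : -(g₀₃ * s) + g₁₃ + r * h₁₂ + h₁₃ = 0)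
    (e₂₂ : g₀₂ * h₀₂ + g₁₂ * h₁₂ + h₂₂ + r * h₂₃ = 1)
    (e₃₂ : g₀₃ * h₀₂ + g₁₃ * h₁₂ + r * h₂₂ + h₂₃ = 0)
    (e₃₃ : g₀₃ * h₀₃ + g₁₃ * h₁₃ + r * h₂₃ + h₃₃ = 1) :
    0 ≤ g₀₁ * s * (h₂₂ * h₃₃ - (r * h₂₃) ^ 2)
      + (g₀₂ * h₀₂) * (g₁₂ * h₁₂) * h₃₃ + (g₀₃ * h₀₃) * (g₁₃ * h₁₃) * h₂₂
      - r * h₂₃ * ((g₀₂ * h₀₂) * (g₁₃ * h₁₃) + (g₀₃ * h₀₃) * (g₁₂ * h₁₂)) := by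
  obtain ⟨ρ, hρ⟩ : ∃ ρ, ρ = 1 - r ^ 2 := ⟨_, rfl⟩
  obtain ⟨σ, hσ⟩ : ∃ σ, σ = 1 - s ^ 2 := ⟨_, rfl⟩
  have hρ₀ : 0 < ρ := by linarith
  have hσ₀ : 0 < σ := by linarith
  have solve (x y : ℝ) : ∃ a b, x = a + r * b ∧ y = b + r * a := by
    refine ⟨(x - r * y) / ρ, (y - r * x) / ρ, ?_, ?_⟩ <;> field_simp <;> rw [hρ] <;> ring
  obtain ⟨a, b, rfl, rfl⟩ := solve g₀₂ g₀₃
  obtain ⟨c, d, rfl, rfl⟩ := solve g₁₂ g₁₃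
  have k₀₂ : h₀₂ = -(a - s * c) := by
    apply mul_left_cancel₀ hρ₀.ne'
    rw [hρ]
    linear_combination e₂₀ - r * e₃₀
  have k₀₃ : h₀₃ = -(b - s * d) := by
    apply mul_left_cancel₀ hρ₀.ne'
    rw [hρ]
    linear_combination e₃₀ - r * e₂₀
  have k₁₂ : h₁₂ = -(c - s * a) := by
    apply mul_left_cancel₀ hρ₀.ne'
    rw [hρ]
    linear_combination e₂₁ - r * e₃₁
  have k₁₃ : h₁₃ = -(d - s * b) := by
    apply mul_left_cancel₀ hρ₀.ne'
    rw [hρ]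
    linear_combination e₃₁ - r * e₂₁
  subst k₀₂ k₀₃ k₁₂ k₁₃
  obtain ⟨α, hα⟩ : ∃ α, α = a ^ 2 - 2 * s * a * c + c ^ 2 := ⟨_, rfl⟩
  obtain ⟨β, hβ⟩ : ∃ β, β = b ^ 2 - 2 * s * b * d + d ^ 2 := ⟨_, rfl⟩
  obtain ⟨γ, hγ⟩ : ∃ γ, γ = a * b - s * (a * d + b * c) + c * d := ⟨_, rfl⟩
  obtain ⟨q, hq⟩ : ∃ q, q = a * c + b * d + r * (a * d + b * c) := ⟨_, rfl⟩
  have k₂₂ : ρ * h₂₂ = 1 + ρ * α := by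
    rw [hρ, hα]
    linear_combination e₂₂ - r * e₃₂
  have k₂₃ : ρ * h₂₃ = -r + ρ * γ := by
    rw [hρ, hγ]
    linear_combination e₃₂ - r * e₂₂
  have k₃₃ : ρ * h₃₃ = 1 + ρ * β := by
    have : h₃₃ = 1 + β + r * γ - r * h₂₃ := by
      rw [hβ, hγ]
      linear_combination e₃₃
    rw [this]
    linear_combination (-r) * k₂₃ + hρ
  have k₀₁ : σ * g₀₁ = s + σ * q := by
    rw [hσ, hq]
    linear_combination e₀₁ + s * e₀₀
  have key := cofactor_polynomial_nonneg hr hs a b c d hρ hσ hq hα hβ hγ rfl rfl rfl rfl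
  have k₂₃₂₃ : ρ * (h₂₂ * h₃₃ - (r * h₂₃) ^ 2)
      = 1 + r ^ 2 + α + β + 2 * r ^ 3 * γ + ρ * (α * β - r ^ 2 * γ ^ 2) := by
    apply mul_left_cancel₀ hρ₀.ne'
    linear_combination (ρ * h₃₃) * k₂₂ + (1 + ρ * α) * k₃₃
      - r ^ 2 * (ρ * h₂₃ - r + ρ * γ) * k₂₃ - (1 + r ^ 2) * hρ
  refine nonneg_of_mul_nonneg_right (a := σ * ρ) (key.trans_eq ?_) (mul_pos hσ₀ hρ₀)
  rw [← k₂₃₂₃, ← k₀₁, ← k₂₂, ← k₃₃]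
  linear_combination (-σ * r * ((a + r * b) * (a - s * c) * ((d + r * c) * (d - s * b))
    + (b + r * a) * (b - s * d) * ((c + r * d) * (c - s * a)))) * (-k₂₃)

theorem Matrix.PosDef.sq_lt_mul_diag {ι : Type*} {M : Matrix ι ι ℝ} (hM : M.PosDef) {i j : ι}
    (hij : i ≠ j) : M i j ^ 2 < M i i * M j j := by
  have hsub : (M.submatrix ![i, j] ![i, j]).PosDef := by
    apply hM.submatrix
    intro x y
    fin_cases x <;> fin_cases y <;> simp [hij, hij.symm]
  have hdet := hsub.det_pos
  have hsymm : M j i = M i j := by simpa using hM.isHermitian.apply i j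
  rw [det_fin_two] at hdet
  simp only [submatrix_apply, cons_val_zero, cons_val_one, hsymm] at hdet
  linarith

theorem inv_relGain_zero_one_nonneg_of_normalized {G : Matrix (Fin 4) (Fin 4) ℝ} (hG : G.PosDef)
    (h₀ : G⁻¹ 0 0 = 1) (h₁ : G⁻¹ 1 1 = 1) (h₂ : G 2 2 = 1) (h₃ : G 3 3 = 1) :
    0 ≤ (relGain G)⁻¹ 0 1 := by
  have hmul := mul_nonsing_inv G (G.isUnit_iff_isUnit_det.mp hG.isUnit)
  have gsymm (i j : Fin 4) : G j i = G i j := by simpa using hG.isHermitian.apply i j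
  have hsymm (i j : Fin 4) : G⁻¹ j i = G⁻¹ i j := by simpa using hG.inv.isHermitian.apply i j
  have hs := hG.inv.sq_lt_mul_diag (show (0 : Fin 4) ≠ 1 by decide)
  have hr := hG.sq_lt_mul_diag (show (2 : Fin 4) ≠ 3 by decide)
  set H := G⁻¹ with hH
  have entry (i j : Fin 4) := congrFun (congrFun hmul i) j
  simp only [mul_apply, Fin.sum_univ_four] at entry
  have e₀₀ := entry 0 0
  have e₀₁ := entry 0 1
  have e₂₀ := entry 2 0
  have e₃₀ := entry 3 0
  have e₂₁ := entry 2 1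
  have e₃₁ := entry 3 1
  have e₂₂ := entry 2 2
  have e₃₂ := entry 3 2
  have e₃₃ := entry 3 3
  simp [h₀, h₁, h₂, h₃, gsymm 0 2, gsymm 0 3, gsymm 1 2, gsymm 1 3, gsymm 2 3, hsymm 0 1,
    hsymm 0 2, hsymm 0 3, hsymm 1 2, hsymm 1 3, hsymm 2 3] at e₀₀ e₀₁ e₂₀ e₃₀ e₂₁ e₃₁ e₂₂ e₃₂ e₃₃
  have key := cofactor_nonneg_of_normalized (r := G 2 3) (s := -H 0 1) (g₀₀ := G 0 0)
    (g₀₁ := G 0 1) (g₀₂ := G 0 2) (g₀₃ := G 0 3) (g₁₂ := G 1 2) (g₁₃ := G 1 3) (h₀₂ := H 0 2)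
    (h₀₃ := H 0 3) (h₁₂ := H 1 2) (h₁₃ := H 1 3) (h₂₂ := H 2 2) (h₂₃ := H 2 3) (h₃₃ := H 3 3)
    (by simpa [h₂, h₃] using hr) (by simpa [h₀, h₁] using hs) (by linarith) (by linarith)
    (by linarith) (by linarith) (by linarith) (by linarith) (by linarith) (by linarith)
    (by linarith)
  have hadj : 0 ≤ (relGain G).adjugate 0 1 := by
    refine key.trans_eq ?_
    rw [adjugate_fin_succ_eq_det_submatrix, det_fin_three]
    simp [relGain, ← hH, Fin.succAbove, h₂, h₃, gsymm 1 2, gsymm 1 3, gsymm 2 3,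
      hsymm 0 1, hsymm 0 2, hsymm 0 3, hsymm 2 3]
    ring
  rw [inv_def, Matrix.smul_apply, Ring.inverse_eq_inv']
  exact mul_nonneg (inv_nonneg.mpr (relGain_posDef hG).det_pos.le) hadj

theorem inv_relGain_zero_one_nonneg {G : Matrix (Fin 4) (Fin 4) ℝ} (hG : G.PosDef) :
    0 ≤ (relGain G)⁻¹ 0 1 := by
  obtain ⟨d, hd⟩ : ∃ d : Fin 4 → ℝ, d = ![√(G⁻¹ 0 0), √(G⁻¹ 1 1), (√(G 2 2))⁻¹, (√(G 3 3))⁻¹] :=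
    ⟨_, rfl⟩
  have p₀ : 0 < G⁻¹ 0 0 := hG.inv.diag_pos
  have p₁ : 0 < G⁻¹ 1 1 := hG.inv.diag_pos
  have p₂ : 0 < G 2 2 := hG.diag_pos
  have p₃ : 0 < G 3 3 := hG.diag_pos
  have hd₀ (i : Fin 4) : d i ≠ 0 := by
    rw [hd]
    fin_cases i <;> simp <;> positivity
  have hinv : (diagonal d)⁻¹ = diagonal fun i => (d i)⁻¹ := by
    apply inv_eq_right_inv
    simp [diagonal_mul_diagonal, hd₀]
  have hunit : IsUnit (diagonal d) := by
    simp [isUnit_diagonal, Pi.isUnit_iff, hd₀]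
  have hpos : (diagonal d * G * diagonal d).PosDef := by
    have := hunit.posDef_star_right_conjugate_iff.mpr hG
    simpa [star_eq_conjTranspose, diagonal_conjTranspose] using this
  rw [← relGain_diagonal_mul_mul_diagonal G hd₀]
  apply inv_relGain_zero_one_nonneg_of_normalized hpos
  all_goals
    simp only [Matrix.mul_inv_rev, hinv, diagonal_mul, mul_diagonal]
    simp [hd]
    field_simp
    rw [Real.sq_sqrt (by positivity)]

theorem inv_relGain_nonneg_fin_four {G : Matrix (Fin 4) (Fin 4) ℝ} (hG : G.PosDef)
    (i j : Fin 4) : 0 ≤ (relGain G)⁻¹ i j := by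
  by_cases hij : i = j
  · subst hij
    exact (relGain_posDef hG).inv.diag_pos.le
  · obtain ⟨e, rfl, rfl⟩ : ∃ e : Equiv.Perm (Fin 4), e 0 = i ∧ e 1 = j := by
      revert i j
      decide
    have h := inv_relGain_zero_one_nonneg (hG.submatrix e.injective)
    rwa [inv_relGain_submatrix] at h

theorem inv_relGain_nonneg {n : ℕ} (hn : n ≤ 4) {G : Matrix (Fin n) (Fin n) ℝ} (hG : G.PosDef)
    (i j : Fin n) : 0 ≤ (relGain G)⁻¹ i j := by
  let e : Fin 4 ≃ Fin n ⊕ Fin (4 - n) :=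
    (finCongr (Nat.add_sub_cancel' hn)).symm.trans finSumFinEquiv.symm
  have h := inv_relGain_nonneg_fin_four
    ((posDef_fromBlocks_one (κ := Fin (4 - n)) hG).submatrix e.injective)
    (e.symm (.inl i)) (e.symm (.inl j))
  rw [inv_relGain_submatrix, relGain_fromBlocks_one hG.isUnit,
    inv_fromBlocks_zero₂₁_of_isUnit_iff _ _ _ (by simp [(relGain_posDef hG).isUnit])] at h
  simpa using h

theorem IsPermMatrix.transpose {n : ℕ} {P : Matrix (Fin n) (Fin n) ℝ} (hP : IsPermMatrix P) :
    IsPermMatrix Pᵀ :=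
  ⟨fun i j => hP.1 j i, hP.2.2, hP.2.1⟩

/-- Multiplication by a permutation matrix on either side permutes rows or columns. -/
theorem IsPermMatrix.exists_perm {n : ℕ} {P : Matrix (Fin n) (Fin n) ℝ} (hP : IsPermMatrix P) :
    ∃ e : Equiv.Perm (Fin n), (∀ M : Matrix (Fin n) (Fin n) ℝ, P * M = M.submatrix e id) ∧
      ∀ M : Matrix (Fin n) (Fin n) ℝ, M * P = M.submatrix id e.symm := by
  obtain ⟨h01, hrow, hcol⟩ := hP
  choose f hf hf' using hrow
  have hinj : Function.Injective f := fun i j hij =>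
    (hcol (f j)).unique (by rw [← hij]; exact hf i) (hf j)
  let e : Equiv.Perm (Fin n) := Equiv.ofBijective f (Finite.injective_iff_bijective.mp hinj)
  have hPe : P = e.toPEquiv.toMatrix := by
    ext i j
    rw [PEquiv.toMatrix_apply]
    by_cases h : f i = j
    · simp [e, ← h, hf]
    · have : P i j = 0 := (h01 i j).resolve_right fun h' => h (hf' i j h').symm
      simp [e, h, this]
  refine ⟨e, fun M => ?_, fun M => ?_⟩
  · rw [hPe, PEquiv.toMatrix_toPEquiv_mul]
  · rw [hPe, PEquiv.mul_toMatrix_toPEquiv]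

/-- For `n ≤ 4` and `G` positive-definite up to permutations (some `P * G * Q` with
`P`, `Q` permutation matrices is symmetric positive-definite), `RGA G` is invertible,
`IRGA G` is positive-definite up to permutations, and `IRGA G` has unit row and
column sums and nonnegative entries, hence is doubly stochastic. -/
theorem irga_doubly_stochastic_up_to_perm_of_dim_le_four {n : ℕ} (hn : n ≤ 4)
    (G : Matrix (Fin n) (Fin n) ℝ)
    (hG : ∃ P Q : Matrix (Fin n) (Fin n) ℝ,
      IsPermMatrix P ∧ IsPermMatrix Q ∧ (P * G * Q).PosDef) :
    IsUnit (RGA G).det ∧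
      (∃ P' Q' : Matrix (Fin n) (Fin n) ℝ,
        IsPermMatrix P' ∧ IsPermMatrix Q' ∧ (P' * IRGA G * Q').PosDef) ∧
      (∀ i, ∑ j, IRGA G i j = 1) ∧
      (∀ j, ∑ i, IRGA G i j = 1) ∧
      (∀ i j, 0 ≤ IRGA G i j) := by
  obtain ⟨P, Q, hP, hQ, hPD⟩ := hG
  obtain ⟨e, heP, -⟩ := hP.exists_perm
  obtain ⟨f, -, hfQ⟩ := hQ.exists_perm
  have hPGQ (M : Matrix (Fin n) (Fin n) ℝ) : P * M * Q = M.submatrix e f.symm := by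
    rw [hfQ, heP]
    rfl
  rw [hPGQ] at hPD
  have hdetG : IsUnit G.det := by
    rw [← isUnit_iff_isUnit_det, ← isUnit_submatrix_equiv e f.symm]
    exact hPD.isUnit
  have hRGA : RGA G = relGain G := rfl
  have hA : IsUnit (relGain G).det := by
    rw [← isUnit_iff_isUnit_det, ← isUnit_submatrix_equiv e f.symm, ← relGain_submatrix]
    exact (relGain_posDef hPD).isUnit
  have hinv := inv_relGain_submatrix G e f.symm
  simp only [IRGA, hRGA]
  refine ⟨hA, ?_, fun i => ?_, fun j => ?_, fun i j => ?_⟩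
  · refine ⟨Qᵀ, Pᵀ, hQ.transpose, hP.transpose, ?_⟩
    have h : Qᵀ * (relGain G)⁻¹ * Pᵀ = (P * ((relGain G)⁻¹)ᵀ * Q)ᵀ := by
      simp [transpose_mul, Matrix.mul_assoc]
    rw [h, hPGQ, transpose_submatrix, transpose_transpose, ← hinv]
    exact (relGain_posDef hPD).inv
  · have h := congrArg ((relGain G)⁻¹ *ᵥ ·) (relGain_mulVec_one hdetG)
    simp only [mulVec_mulVec, nonsing_inv_mul _ hA, one_mulVec] at h
    simpa [mulVec, dotProduct] using (congrFun h i).symm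
  · have h := congrArg (· ᵥ* (relGain G)⁻¹) (one_vecMul_relGain hdetG)
    simp only [vecMul_vecMul, mul_nonsing_inv _ hA, vecMul_one] at h
    simpa [vecMul, dotProduct] using (congrFun h j).symm
  · have h := inv_relGain_nonneg hn hPD (f i) (e.symm j)
    simpa [hinv] using h
end

section
/- Let M be the 7×7 integer matrix with rows (54, −10, 0, 0, −4, −2, −4), (−10, 55, −5, −3, −3, 1, −1), (0, −5, 52, −8, 2, −2, −4), (0, −3, −8, 57, −7, −3, −1), (−4, −3, 2, −7, 52, −6, 1), (−2, 1, −2, −3, −6, 56, −9), (−4, −1, −4, −1, 1, −9, 53), regarded as a real matrix. Then M is symmetric positive-definite, RGA(M) is invertible, and IRGA(M) has at least one strictly negative entry. Hence the nonnegativity of IRGA of positive-definite matrices fails for n = 7. -/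
open Matrix

/-- The `7 × 7` integer counterexample matrix, regarded as a real matrix. -/
def M7 : Matrix (Fin 7) (Fin 7) ℝ :=
  !![54, -10, 0, 0, -4, -2, -4;
     -10, 55, -5, -3, -3, 1, -1;
     0, -5, 52, -8, 2, -2, -4;
     0, -3, -8, 57, -7, -3, -1;
     -4, -3, 2, -7, 52, -6, 1;
     -2, 1, -2, -3, -6, 56, -9;
     -4, -1, -4, -1, 1, -9, 53]

/-- An integer multiple of the inverse of `M7`. -/
def M7InvScaled : Matrix (Fin 7) (Fin 7) ℝ :=
  !![5622151131, 1078888704, 161383542, 172414161, 540731988, 335934390, 506945643;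
     1078888704, 5537619376, 604415758, 438559524, 441791652, 71203880, 243555472;
     161383542, 604415758, 5783721904, 866537172, -30652404, 330348920, 533116366;
     172414161, 438559524, 866537172, 5317781841, 766648143, 435925215, 246581613;
     540731988, 441791652, -30652404, 766648143, 5786279874, 682282590, 67981539;
     335934390, 71203880, 330348920, 435925215, 682282590, 5416213660, 966715145;
     506945643, 243555472, 533116366, 246581613, 67981539, 966715145, 5683538389]

/-- An integer multiple of the column of `IRGA M7` with index `1`. -/
def irgaColScaled : Fin 7 → ℝ :=
  ![41446657204689830995368037071420996876709910253318232528786,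
    1164944254566605111253759709945319576158556009782951729836716,
    11841198485993949258247144389355222094913874224576803742521,
    5426154278797099481628746686271948246215355847990503683446,
    5528021708938349129794958009239841000214995422196058748731,
    -20367587220048624278561991630654082475681615148673205887,
    1307348226987982792127661042810687185218207583699267883326]

theorem M7_isHermitian : M7.IsHermitian := by
  ext i j
  fin_cases i <;> fin_cases j <;> simp [M7]

/-- The quadratic form of `M7` is a sum of squares, by strict diagonal dominance. -/
theorem M7_quadratic_form (x : Fin 7 → ℝ) :
    x ⬝ᵥ (M7 *ᵥ x) =
      29 * ∑ i, x i ^ 2 +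
      (5 * x 0 ^ 2 + 3 * x 1 ^ 2 + 2 * x 2 ^ 2 + 6 * x 3 ^ 2 + 4 * x 5 ^ 2 + 4 * x 6 ^ 2 +
        10 * (x 0 - x 1) ^ 2 + 4 * (x 0 - x 4) ^ 2 + 2 * (x 0 - x 5) ^ 2 +
        4 * (x 0 - x 6) ^ 2 + 5 * (x 1 - x 2) ^ 2 + 3 * (x 1 - x 3) ^ 2 +
        3 * (x 1 - x 4) ^ 2 + (x 1 + x 5) ^ 2 + (x 1 - x 6) ^ 2 + 8 * (x 2 - x 3) ^ 2 +
        2 * (x 2 + x 4) ^ 2 + 2 * (x 2 - x 5) ^ 2 + 4 * (x 2 - x 6) ^ 2 +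
        7 * (x 3 - x 4) ^ 2 + 3 * (x 3 - x 5) ^ 2 + (x 3 - x 6) ^ 2 +
        6 * (x 4 - x 5) ^ 2 + (x 4 + x 6) ^ 2 + 9 * (x 5 - x 6) ^ 2) := by
  simp [M7, dotProduct, mulVec, Fin.sum_univ_succ]
  ring

theorem M7_posDef : M7.PosDef := by
  refine posDef_iff_dotProduct_mulVec.mpr ⟨M7_isHermitian, fun x hx => ?_⟩
  obtain ⟨i, hi⟩ := Function.ne_iff.mp hx
  have hpos : 0 < ∑ i, x i ^ 2 :=
    Finset.sum_pos' (fun _ _ => sq_nonneg _) ⟨i, Finset.mem_univ i, sq_pos_of_ne_zero hi⟩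
  rw [star_trivial, M7_quadratic_form]
  positivity

theorem M7_inv : M7⁻¹ = (287944694730 : ℝ)⁻¹ • M7InvScaled := by
  refine inv_eq_right_inv ?_
  rw [mul_smul_comm, inv_smul_eq_iff₀ (by norm_num)]
  ext i j
  fin_cases i <;> fin_cases j <;>
    norm_num [M7, M7InvScaled, mul_apply, Fin.sum_univ_succ]

theorem RGA_posDef {n : ℕ} {G : Matrix (Fin n) (Fin n) ℝ} (hG : G.PosDef) : (RGA G).PosDef :=
  hG.hadamard hG.inv.transpose

theorem RGA_M7_mulVec :
    RGA M7 *ᵥ irgaColScaled =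
      Pi.single 1 (354308249206567329498931199095827531223616217072957664092918821206342470
        / 287944694730) := by
  rw [RGA, M7_inv]
  ext i
  fin_cases i <;>
    norm_num [M7, M7InvScaled, irgaColScaled, mulVec, dotProduct, Fin.sum_univ_succ]

/-- `M7` is symmetric positive-definite, `RGA M7` is invertible, and `IRGA M7` has a
strictly negative entry: nonnegativity of the IRGA of positive-definite matrices
fails for `n = 7`. -/
theorem irga_counterexample_dim_seven :
    M7.PosDef ∧ IsUnit (RGA M7).det ∧ ∃ i j, IRGA M7 i j < 0 := by
  have hunit : IsUnit (RGA M7).det :=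
    (isUnit_iff_isUnit_det _).mp (RGA_posDef M7_posDef).isUnit
  refine ⟨M7_posDef, hunit, 5, 1, ?_⟩
  have hcol := congrFun (congrArg ((RGA M7)⁻¹ *ᵥ ·) RGA_M7_mulVec) 5
  simp only [mulVec_mulVec, nonsing_inv_mul _ hunit, one_mulVec, mulVec_single] at hcol
  have hneg : irgaColScaled 5 < 0 := by simp [irgaColScaled]
  rw [hcol] at hneg
  exact neg_of_mul_neg_left hneg (by norm_num)
end

section
/- For all real numbers a, b, c, d, e, f, the polynomial J₄₁₂(a,b,c,d,e,f) is nonnegative: J₄₁₂(a,b,c,d,e,f) ≥ 0. -/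
/-- The polynomial `J₄₁₂`, the numerator of the `(1,2)` entry of `IRGA(G)` for a
`4 × 4` positive-definite matrix `G = L Lᵀ` with unit lower-triangular `L`. -/
def J412 (a b c d e f : ℝ) : ℝ :=
  -(d^2 + e^2 + f^2 + 1) *
      (a * (f^2 + 1) * (b^2 + c^2 + 1) *
          (-a*c^2*f^2 - a*c^2 + 2*a*c*e*f - a*e^2 - a + b*c*f^2 + b*c - b*e*f - c*d*f + d*e)
        - b * (a*b + c) * (-c*f^2 - c + e*f) *
          (a*c*f^2 + a*c - a*e*f - b*f^2 - b + d*f))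
    - (a*d + e) * (c*f - e) *
      (d * (f^2 + 1) * (-(b^2 + c^2 + 1)) * (-a*c*f + a*e + b*f - d)
        - b*f * (b*d + c*e + f) * (a*c*f^2 + a*c - a*e*f - b*f^2 - b + d*f))
    - f * (b*d + c*e + f) *
      (d * (-(a*b + c)) * (-c*f^2 - c + e*f) * (-a*c*f + a*e + b*f - d)
        - a*f * (b*d + c*e + f) *
          (-a*c^2*f^2 - a*c^2 + 2*a*c*e*f - a*e^2 - a + b*c*f^2 + b*c - b*e*f - c*d*f + d*e))

/-- The part of `J412` of degree two in `(a, b, d)`, written in the coordinates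
`x = a`, `y = b - c a`, `z = g a - f b + d` with `g = c f - e`, is a nonnegative quadratic form. -/
theorem J412_quadratic_part_nonneg (c e f g x y z : ℝ) :
    0 ≤ (x - c * y / 2 + g * z / 2) ^ 2
      + f ^ 2 * (2 * (x - c * y / 2 + g * z / 2) ^ 2 + (c * y) ^ 2 / 2 + (g * z) ^ 2 / 2)
      + ((c * x - c * e * z / 2) ^ 2 + 3 / 4 * (c * e * z) ^ 2)
      + ((c * e * y - (e + c * f) * x / 2) ^ 2
          + (3 / 4 * (e - c * f / 3) ^ 2 + 5 / 3 * (c * f) ^ 2 + (c * e) ^ 2 + (f * g) ^ 2) * x ^ 2)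
      + ((f * g * y + (c * y + g * z - c * f * z) / 2) ^ 2
          + (c * y - c * f * z / 2) ^ 2 / 2 + (g * z - c * f * z / 2) ^ 2 / 2
          + (c * f * z) ^ 2 / 2) := by
  positivity

/-- The part of `J412` of degree four in `(a, b, d)`, written in the products
`x = b d`, `y = a d`, `z = a b` and with `g = c f - e`, is a nonnegative quadratic form. -/
theorem J412_quartic_part_nonneg (c e f g x y z : ℝ) :
    0 ≤ (g * x - c ^ 2 * f * y + e ^ 2 * z + z / 2) ^ 2
      + (c * x - c ^ 2 * y - y / 2 - f * z / 2) ^ 2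
      + (f * y - f ^ 2 * z) ^ 2 + 2 * (c * f * y - e * f * z) ^ 2
      + ((y / 2 - f * z / 2) ^ 2 + y ^ 2 / 2 + (c * y) ^ 2
          + (3 / 4 + e ^ 2 + 3 / 2 * f ^ 2) * z ^ 2) := by
  positivity

/-- `J₄₁₂` is nonnegative for all real `a, b, c, d, e, f`. -/
theorem J412_nonneg (a b c d e f : ℝ) : 0 ≤ J412 a b c d e f := by
  have h₂ := J412_quadratic_part_nonneg c e f (c * f - e) a (b - c * a)
    ((c * f - e) * a - f * b + d)
  have h₄ := J412_quartic_part_nonneg c e f (c * f - e) (b * d) (a * d) (a * b)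
  have h₆ := sq_nonneg (a * b * d)
  refine (add_nonneg (add_nonneg h₂ h₄) h₆).trans_eq ?_
  unfold J412
  ring
end

section
/- The polynomial J₄₁₂ is a sum of squares with rational coefficients: there exist finitely many polynomials q₁, …, q_m in ℚ[a,b,c,d,e,f] and positive rational numbers c₁, …, c_m such that J₄₁₂ = ∑_{i=1}^m c_i · q_i². (In fact it is a weighted sum of 25 such squares.) -/
open MvPolynomial

/-- The polynomial `J₄₁₂` as a multivariate polynomial over `ℚ` in the six variables
`a = X 0, b = X 1, c = X 2, d = X 3, e = X 4, f = X 5`. -/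
noncomputable def J412Q : MvPolynomial (Fin 6) ℚ :=
  let a : MvPolynomial (Fin 6) ℚ := X 0
  let b : MvPolynomial (Fin 6) ℚ := X 1
  let c : MvPolynomial (Fin 6) ℚ := X 2
  let d : MvPolynomial (Fin 6) ℚ := X 3
  let e : MvPolynomial (Fin 6) ℚ := X 4
  let f : MvPolynomial (Fin 6) ℚ := X 5
  (-(d^2 + e^2 + f^2 + 1) *
      (a * (f^2 + 1) * (b^2 + c^2 + 1) *
          (-a*c^2*f^2 - a*c^2 + 2*a*c*e*f - a*e^2 - a + b*c*f^2 + b*c - b*e*f - c*d*f + d*e)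
        - b * (a*b + c) * (-c*f^2 - c + e*f) *
          (a*c*f^2 + a*c - a*e*f - b*f^2 - b + d*f))
    - (a*d + e) * (c*f - e) *
      (d * (f^2 + 1) * (-(b^2 + c^2 + 1)) * (-a*c*f + a*e + b*f - d)
        - b*f * (b*d + c*e + f) * (a*c*f^2 + a*c - a*e*f - b*f^2 - b + d*f))
    - f * (b*d + c*e + f) *
      (d * (-(a*b + c)) * (-c*f^2 - c + e*f) * (-a*c*f + a*e + b*f - d)
        - a*f * (b*d + c*e + f) *
          (-a*c^2*f^2 - a*c^2 + 2*a*c*e*f - a*e^2 - a + b*c*f^2 + b*c - b*e*f - c*d*f + d*e)))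

/-- The weights of the squares in a decomposition of `2 * J₄₁₂`. -/
def sosWeight : Fin 27 → ℕ :=
  ![1, 1, 1, 1, 2, 2, 2, 2, 2, 1, 1, 1, 2, 1, 1, 1, 1, 1, 1, 3, 1, 1, 1, 3, 2, 2, 4]

/-- The polynomials whose squares, weighted by `sosWeight`, add up to `2 * J₄₁₂`. -/
noncomputable def sosBase : Fin 27 → MvPolynomial (Fin 6) ℚ :=
  let a : MvPolynomial (Fin 6) ℚ := X 0
  let b : MvPolynomial (Fin 6) ℚ := X 1
  let c : MvPolynomial (Fin 6) ℚ := X 2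
  let d : MvPolynomial (Fin 6) ℚ := X 3
  let e : MvPolynomial (Fin 6) ℚ := X 4
  let f : MvPolynomial (Fin 6) ℚ := X 5
  ![f * (b * e - c * d) + a + c * (f ^ 2 + 1) * (a * c - b) - e * (a * e - d)
        - 2 * (c * f - e) * (a * e - d),
      f * (b * e - c * d),
      a,
      c * (f ^ 2 + 1) * (a * c - b) - e * (a * e - d),
      a * f,
      a * f + c * f * (a * c - b) + f * (c * f - e) * (f * (a * c - b) - (a * e - d)),
      a * c * e,
      a * b * d,
      a * f * (c * f - e),
      a * c,
      c * e * (f * (a * c - b) - (a * e - d)),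
      a * c - c * e * (f * (a * c - b) - (a * e - d)),
      a * f * (b * f - d),
      a * b,
      b * e * (a * e - d) - c * d * f * (a * c - b),
      a * b + b * e * (a * e - d) - c * d * f * (a * c - b),
      a * e,
      a * e + c * e * (a * c - b),
      c * e * (a * c - b) + a * c * f,
      a * c * f,
      a * d,
      a * d + c * d * (a * c - b),
      c * d * (a * c - b) + a * b * f,
      a * b * f,
      a * c * d,
      a * b * e,
      a * f * (b * e - c * d)]

theorem sosWeight_pos (i : Fin 27) : 0 < sosWeight i := by
  revert i
  decide

theorem two_mul_J412Q :
    2 * J412Q = ∑ i, (sosWeight i : MvPolynomial (Fin 6) ℚ) * sosBase i ^ 2 := by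
  simp only [Fin.sum_univ_succ, Fin.sum_univ_zero, sosWeight, sosBase, J412Q,
    Matrix.cons_val_zero, Matrix.cons_val_succ, Nat.cast_ofNat, Nat.cast_one]
  ring

/-- `J₄₁₂` is a sum of squares with rational coefficients: there are polynomials
`q₁, …, q_m ∈ ℚ[a,…,f]` and positive rationals `c₁, …, c_m` with
`J₄₁₂ = ∑ i, cᵢ • qᵢ²`. -/
theorem J412Q_is_rational_sos :
    ∃ (m : ℕ) (q : Fin m → MvPolynomial (Fin 6) ℚ) (c : Fin m → ℚ),
      (∀ i, 0 < c i) ∧ J412Q = ∑ i, C (c i) * (q i) ^ 2 := by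
  refine ⟨_, sosBase, fun i => 1 / 2 * sosWeight i, fun i => ?_, ?_⟩
  · have := sosWeight_pos i
    positivity
  · have half : (C (1 / 2 : ℚ) : MvPolynomial (Fin 6) ℚ) * 2 = 1 := by
      rw [← map_ofNat C 2, ← C_mul]
      norm_num
    calc J412Q = C (1 / 2 : ℚ) * (2 * J412Q) := by rw [← mul_assoc, half, one_mul]
      _ = ∑ i, C (1 / 2 * (sosWeight i : ℚ)) * sosBase i ^ 2 := by
        simp only [two_mul_J412Q, Finset.mul_sum, C_mul, map_natCast, mul_assoc]
end

section
/- Let a, b, c, d, e, f be real numbers, let L be the 4×4 lower triangular matrix with rows (1,0,0,0), (a,1,0,0), (b,c,1,0), (d,e,f,1), and let G = L·Lᵀ. Then G is symmetric positive-definite, det(G ∘ (G⁻¹)ᵀ) > 0, and the (1,2) entry of IRGA(G) equals J₄₁₂(a,b,c,d,e,f) / det(G ∘ (G⁻¹)ᵀ). -/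
open Matrix

/-- A right inverse of the unit lower-triangular `4 × 4` matrix with subdiagonal entries
`a, b, c, d, e, f`. -/
lemma unitLowerTriangular_mul_inverse (a b c d e f : ℝ) :
    (!![1, 0, 0, 0; a, 1, 0, 0; b, c, 1, 0; d, e, f, 1] : Matrix (Fin 4) (Fin 4) ℝ) *
      !![1, 0, 0, 0; -a, 1, 0, 0; a*c - b, -c, 1, 0;
        -a*c*f + a*e + b*f - d, c*f - e, -f, 1] = 1 := by
  ext i j
  fin_cases i <;> fin_cases j <;> simp [Matrix.mul_apply, Fin.sum_univ_four] <;> ring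

/-- The Gram matrix of the rows of an invertible square real matrix is positive definite. -/
lemma posDef_mul_transpose_of_mul_eq_one {n : ℕ} {L K : Matrix (Fin n) (Fin n) ℝ}
    (h : L * K = 1) : (L * Lᵀ).PosDef := by
  rw [← conjTranspose_eq_transpose_of_trivial]
  exact PosDef.mul_conjTranspose_self L (vecMul_injective_of_isUnit (IsUnit.of_mul_eq_one _ h))

/-- The inverse of `L * Lᵀ` in terms of a right inverse of `L`. -/
lemma inv_mul_transpose_of_mul_eq_one {n : ℕ} {L K : Matrix (Fin n) (Fin n) ℝ}
    (h : L * K = 1) : (L * Lᵀ)⁻¹ = Kᵀ * K := by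
  apply inv_eq_left_inv
  have h' : K * L = 1 := mul_eq_one_comm.mp h
  rw [Matrix.mul_assoc, ← Matrix.mul_assoc K, h', Matrix.one_mul, ← transpose_mul, h,
    transpose_one]

/-- For `G = L * Lᵀ` with `L` the unit lower-triangular matrix with subdiagonal entries
`a, b, c, d, e, f`: `G` is symmetric positive-definite, `det (RGA G) > 0`, and the
`(1,2)` entry of `IRGA G` equals `J₄₁₂(a,…,f) / det (RGA G)`. -/
theorem irga_entry_eq_J412_div_det (a b c d e f : ℝ) :
    let L : Matrix (Fin 4) (Fin 4) ℝ :=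
      !![1, 0, 0, 0; a, 1, 0, 0; b, c, 1, 0; d, e, f, 1]
    let G := L * Lᵀ
    G.PosDef ∧ 0 < (Matrix.hadamard G (G⁻¹)ᵀ).det ∧
      IRGA G 0 1 = J412 a b c d e f / (Matrix.hadamard G (G⁻¹)ᵀ).det := by
  intro L G
  have hL := unitLowerTriangular_mul_inverse a b c d e f
  have hG : G.PosDef := posDef_mul_transpose_of_mul_eq_one hL
  refine ⟨hG, (hG.hadamard hG.inv.transpose).det_pos, ?_⟩
  have hadj : (Matrix.hadamard G (G⁻¹)ᵀ).adjugate 0 1 = J412 a b c d e f := by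
    have hinv : G⁻¹ = _ := inv_mul_transpose_of_mul_eq_one hL
    rw [hinv, adjugate_fin_succ_eq_det_submatrix, det_fin_three]
    simp [G, L, -cons_mul, Matrix.mul_apply, Fin.sum_univ_four, Fin.succAbove, J412]
    ring
  rw [IRGA, RGA, inv_def, Matrix.smul_apply, hadj, Ring.inverse_eq_inv', smul_eq_mul,
    div_eq_inv_mul]
end

section
/- Let f be a real polynomial in n variables with support A = supp(f) ⊆ ℕⁿ, and let B = Conv({α/2 : α ∈ A}) ∩ ℕⁿ = {β₁, …, β_r}, where Conv denotes the convex hull in ℝⁿ. Define the cross sparsity pattern graph on vertex set {1, …, r} by joining i < j with an edge iff β_i + β_j ∈ A ∪ (2ℕ)ⁿ, let C₁, …, C_t ⊆ {1, …, r} be its connected components, and let B_k = {β_i : i ∈ C_k}. Let Ẽ be the edge set obtained by completing each connected component into a clique. Then the following are equivalent: (i) there exists a real symmetric positive-semidefinite r×r matrix Q with Q_{ij} = 0 whenever i ≠ j and (i,j) ∉ Ẽ, such that f(x) = (x^B)ᵀ Q x^B, where x^B is the column vector of monomials (x^{β₁}, …, x^{β_r}); (ii) there exist polynomials f₁, …,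 f_t such that each f_k is a finite sum of squares of polynomials whose supports are contained in B_k, and f = ∑_{k=1}^t f_k. -/
open MvPolynomial

/-- The square of a linear combination of monomials, expanded as a Gram form of rank one. -/
lemma sq_sum_monomial {σ ι : Type*} [Fintype ι] (β : ι → (σ →₀ ℕ)) (c : ι → ℝ) :
    (∑ i, monomial (β i) (c i)) ^ 2 = ∑ i, ∑ j, monomial (β i + β j) (c i * c j) := by
  simp only [sq, Finset.sum_mul_sum, monomial_mul]

/-- A polynomial whose exponents are enumerated injectively by `β` is the sum of its terms
along `β`. -/
lemma eq_sum_monomial_of_support_subset_range {σ ι : Type*} [Fintype ι] {β : ι → (σ →₀ ℕ)}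
    (hβ : Function.Injective β) {p : MvPolynomial σ ℝ} (hp : ∀ γ ∈ p.support, ∃ i, β i = γ) :
    p = ∑ i, monomial (β i) (p.coeff (β i)) := by
  classical
  ext γ
  simp only [coeff_sum, coeff_monomial]
  by_cases h : ∃ i, β i = γ
  · obtain ⟨i, rfl⟩ := h
    simp [hβ.eq_iff]
  · rw [Finset.sum_eq_zero fun i _ => if_neg fun hi => h ⟨i, hi⟩]
    exact notMem_support_iff.mp fun hγ => h (hp γ hγ)

open scoped MatrixOrder in
/-- A Gram form whose matrix is block diagonal with respect to the labelling `C` splits into sums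
of squares supported on the blocks. -/
lemma exists_blockwise_sum_sq_of_posSemidef {σ : Type*} {r t : ℕ} (β : Fin r → (σ →₀ ℕ))
    (C : Fin r → Fin t) {Q : Matrix (Fin r) (Fin r) ℝ} (hQ : Q.PosSemidef)
    (hblock : ∀ i j, C i ≠ C j → Q i j = 0) :
    ∃ h : Fin t → Fin r → MvPolynomial σ ℝ,
      (∀ k s, ∀ γ ∈ (h k s).support, ∃ i, C i = k ∧ β i = γ) ∧
      ∑ i, ∑ j, monomial (β i + β j) (Q i j) = ∑ k, ∑ s, h k s ^ 2 := by
  classical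
  obtain ⟨M, rfl⟩ := CStarAlgebra.nonneg_iff_eq_star_mul_self.mp hQ.nonneg
  refine ⟨fun k s => ∑ i, monomial (β i) (if C i = k then M s i else 0), ?_, ?_⟩
  · intro k s γ hγ
    rw [mem_support_iff, coeff_sum] at hγ
    obtain ⟨i, -, hi⟩ := Finset.exists_ne_zero_of_sum_ne_zero hγ
    rw [coeff_monomial] at hi
    split_ifs at hi with hβi hCi
    · exact ⟨i, hCi, hβi⟩
    all_goals exact absurd rfl hi
  · have hentry : ∀ i j, (star M * M) i j = ∑ k, ∑ s,
        (if C i = k then M s i else 0) * (if C j = k then M s j else 0) := by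
      intro i j
      rw [Finset.sum_eq_single (C i) (fun k _ hk => by simp [hk.symm]) (by simp)]
      by_cases hij : C i = C j
      · simp [hij, Matrix.mul_apply]
      · simp [hblock i j hij, Ne.symm hij]
    simp only [sq_sum_monomial, hentry, map_sum]
    rw [Finset.sum_congr rfl fun i _ => Finset.sum_comm, Finset.sum_comm]
    refine Finset.sum_congr rfl fun k _ => ?_
    rw [Finset.sum_congr rfl fun i _ => Finset.sum_comm, Finset.sum_comm]

/-- Sums of squares supported on the blocks of the labelling `C` have a positive semidefinite Gram
matrix that is block diagonal with respect to `C`. -/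
lemma exists_posSemidef_of_blockwise_sum_sq {σ : Type*} {r t : ℕ} {β : Fin r → (σ →₀ ℕ)}
    (hβ : Function.Injective β) (C : Fin r → Fin t) (m : Fin t → ℕ)
    (h : ∀ k, Fin (m k) → MvPolynomial σ ℝ)
    (hsupp : ∀ k s, ∀ γ ∈ (h k s).support, ∃ i, C i = k ∧ β i = γ) :
    ∃ Q : Matrix (Fin r) (Fin r) ℝ, Q.PosSemidef ∧ (∀ i j, C i ≠ C j → Q i j = 0) ∧
      ∑ k, ∑ s, h k s ^ 2 = ∑ i, ∑ j, monomial (β i + β j) (Q i j) := by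
  have hcoeff : ∀ k s i, C i ≠ k → (h k s).coeff (β i) = 0 := by
    intro k s i hi
    by_contra hne
    obtain ⟨j, hj, hji⟩ := hsupp k s _ (mem_support_iff.mpr hne)
    exact hi (hβ hji ▸ hj)
  refine ⟨∑ k, ∑ s, Matrix.vecMulVec (fun i => (h k s).coeff (β i))
    (fun i => (h k s).coeff (β i)), ?_, ?_, ?_⟩
  · refine Matrix.posSemidef_sum _ fun k _ => Matrix.posSemidef_sum _ fun s _ => ?_
    simpa using Matrix.posSemidef_vecMulVec_self_star (fun i => (h k s).coeff (β i))
  · intro i j hij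
    simp only [Matrix.sum_apply, Matrix.vecMulVec_apply]
    refine Finset.sum_eq_zero fun k _ => Finset.sum_eq_zero fun s _ => ?_
    by_cases hi : C i = k
    · rw [hcoeff k s j fun hj => hij (hi.trans hj.symm), mul_zero]
    · rw [hcoeff k s i hi, zero_mul]
  · have hsq : ∀ k s, h k s ^ 2 = ∑ i, ∑ j,
        monomial (β i + β j) ((h k s).coeff (β i) * (h k s).coeff (β j)) := by
      intro k s
      rw [← sq_sum_monomial, ← eq_sum_monomial_of_support_subset_range hβ]
      exact fun γ hγ => (hsupp k s γ hγ).imp fun _ hi => hi.2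
    simp only [hsq, Matrix.sum_apply, Matrix.vecMulVec_apply, map_sum]
    symm
    rw [Finset.sum_congr rfl fun i _ => Finset.sum_comm, Finset.sum_comm]
    refine Finset.sum_congr rfl fun k _ => ?_
    rw [Finset.sum_congr rfl fun i _ => Finset.sum_comm, Finset.sum_comm]

/-- Sparse SOS decomposition theorem. Let `f` be a real polynomial in `n` variables
with support `A`, let `β : Fin r → (Fin n →₀ ℕ)` enumerate (injectively) the set
`B = Conv({α/2 : α ∈ A}) ∩ ℕⁿ`, and form the cross sparsity pattern graph on
`Fin r` joining `i ≠ j` iff `β i + β j ∈ A ∪ (2ℕ)ⁿ`. Let `C : Fin r → Fin t` be a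
surjective labelling of its connected components (`C i = C j` iff `i` and `j` are
reachable from one another). Then `f` has a Gram-matrix representation
`f = (x^B)ᵀ Q x^B` with `Q` positive semidefinite and `Q i j = 0` whenever `i` and
`j` lie in distinct components (i.e. `Q` is supported on the completed edge set `Ẽ⋆`)
if and only if `f = ∑ k, f_k` where each `f_k` is a sum of squares of polynomials
supported in `B_k = {β i : C i = k}`. -/
theorem sparse_sos_decomposition {n r t : ℕ} (f : MvPolynomial (Fin n) ℝ)
    (β : Fin r → (Fin n →₀ ℕ)) (hβinj : Function.Injective β)
    (hβB : ∀ γ : Fin n →₀ ℕ,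
      (∃ i, β i = γ) ↔
        (fun l => (γ l : ℝ)) ∈
          convexHull ℝ ((fun (α : Fin n →₀ ℕ) (l : Fin n) => (α l : ℝ) / 2) '' ↑f.support))
    (C : Fin r → Fin t) (hCsurj : Function.Surjective C)
    (hC : ∀ i j, C i = C j ↔
      (SimpleGraph.fromRel (fun i j : Fin r =>
        (β i + β j) ∈ f.support ∨ ∀ l, Even ((β i + β j) l))).Reachable i j) :
    (∃ Q : Matrix (Fin r) (Fin r) ℝ, Q.PosSemidef ∧
        (∀ i j, C i ≠ C j → Q i j = 0) ∧
        f = ∑ i, ∑ j, monomial (β i + β j) (Q i j)) ↔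
    (∃ g : Fin t → MvPolynomial (Fin n) ℝ,
        (∀ k, ∃ (m : ℕ) (h : Fin m → MvPolynomial (Fin n) ℝ),
          (∀ s, ∀ γ ∈ (h s).support, ∃ i, C i = k ∧ β i = γ) ∧
          g k = ∑ s, (h s) ^ 2) ∧
        f = ∑ k, g k) := by
  constructor
  · rintro ⟨Q, hQ, hblock, hf⟩
    obtain ⟨h, hsupp, hsum⟩ := exists_blockwise_sum_sq_of_posSemidef β C hQ hblock
    exact ⟨fun k => ∑ s, h k s ^ 2, fun k => ⟨r, h k, hsupp k, rfl⟩, hf.trans hsum⟩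
  · rintro ⟨g, hg, hf⟩
    choose m h hsupp hgh using hg
    obtain ⟨Q, hQ, hblock, hsum⟩ := exists_posSemidef_of_blockwise_sum_sq hβinj C m h hsupp
    exact ⟨Q, hQ, hblock, by rw [hf, ← hsum]; exact Finset.sum_congr rfl fun k _ => hgh k⟩
end
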